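/- The Vortex order is an N-ary Gray code: for all integers N ≥ 1 and c ≥ 1, the list of all tuples of {1,2,…,N}^c sorted in increasing Vortex order is a Gray code, i.e., every pair of consecutive tuples in this sorted list has Hamming distance exactly 1. -/

import Mathlib

/-- `T(x)`: the list of pairs `(x_1,1), (x_2,2), …, (x_c,c)`, where pairs are
compared lexicographically (first by value, then by index). -/
def Tlist {c : ℕ} (x : Fin c → ℕ) : List (ℕ ×ₗ ℕ) :=
  List.ofFn fun i => toLex (x i, i.1 + 1)

/-- `T'(x)`: the list `T(x)` sorted lexicographically. -/
def Tsorted {c : ℕ} (x : Fin c → ℕ) : List (ℕ ×ₗ ℕ) :=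
  List.insertionSort (· ≤ ·) (Tlist x)

/-- Auxiliary comparison for the alternating lexicographic order.  The Boolean
argument records whether the current (1-based) position is odd; at the first
position where the two lists differ, the comparison is by `<` at odd positions
and by the reversed `<` at even positions. -/
def altB {α : Type*} [LinearOrder α] : Bool → List α → List α → Bool
  | _, [], _ => false
  | _, _ :: _, [] => false
  | oddPos, a :: as, b :: bs =>
      if a = b then altB (!oddPos) as bs
      else if oddPos then decide (a < b) else decide (b < a)

/-- The alternating lexicographic order `<_ALT`: if `j` is the first position where
the lists differ (positions numbered from 1), then `a <_ALT b` iff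
`(a_j < b_j) XOR (j is even)`. -/
def altLt {α : Type*} [LinearOrder α] (a b : List α) : Prop := altB true a b = true

/-- The Vortex order: `x <_VORTEX y` iff `T'(x) <_ALT T'(y)`. -/
def vortexLt {c : ℕ} (x y : Fin c → ℕ) : Prop := altLt (Tsorted x) (Tsorted y)

/-- The non-strict Vortex order. -/
def vortexLe {c : ℕ} (x y : Fin c → ℕ) : Prop := vortexLt x y ∨ x = y

instance {c : ℕ} : DecidableRel (@vortexLe c) := fun x y => by
  unfold vortexLe vortexLt altLt; infer_instance

/-- `VORTEX(N_1,…,N_c)`: the list of all tuples of `{1,…,N_1} × ⋯ × {1,…,N_c}`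
sorted in increasing Vortex order. -/
noncomputable def vortexList {c : ℕ} (Ns : Fin c → ℕ) : List (Fin c → ℕ) :=
  List.insertionSort vortexLe (Fintype.piFinset fun i => Finset.Icc 1 (Ns i)).toList

/-- `Λ_{c,k}^N`: `VORTEX(N,…,N,N-1,…,N-1)` with `c-k` copies of `N` followed by
`k` copies of `N-1`. -/
noncomputable def Lam (c k N : ℕ) : List (Fin c → ℕ) :=
  vortexList fun i => if i.1 < c - k then N else N - 1

/-- A list of tuples is a Gray code if every pair of consecutive tuples has
Hamming distance exactly 1. -/
def IsGrayCode {c : ℕ} (l : List (Fin c → ℕ)) : Prop :=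
  l.Chain' fun x y => hammingDist x y = 1

theorem Prod.Lex.ext_ofLex {a b : ℕ ×ₗ ℕ} (h₁ : (ofLex a).1 = (ofLex b).1)
    (h₂ : (ofLex a).2 = (ofLex b).2) : a = b :=
  ofLex.injective (Prod.ext h₁ h₂)

section altB

variable {α : Type*} [LinearOrder α]

theorem altB_cons_self (b : Bool) (a : α) (l m : List α) :
    altB b (a :: l) (a :: m) = altB (!b) l m := by
  simp [altB]

theorem altB_cons_of_lt {a a' : α} (h : a < a') (l m : List α) :
    altB true (a :: l) (a' :: m) = true := by
  simp [altB, h, h.ne]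

theorem altB_cons_of_gt {a a' : α} (h : a' < a) (l m : List α) :
    altB false (a :: l) (a' :: m) = true := by
  simp [altB, h, h.ne']

theorem altB_not_eq_swap (b : Bool) {l m : List α} (h : l.length = m.length) :
    altB (!b) l m = altB b m l := by
  induction l generalizing b m with
  | nil => cases m <;> simp_all [altB]
  | cons x l ih =>
    cases m with
    | nil => simp at h
    | cons y m =>
      rcases eq_or_ne x y with rfl | hxy
      · simp only [altB_cons_self]
        exact ih (!b) (by simpa using h)
      · cases b <;> simp [altB, hxy, hxy.symm]

theorem altB_asymm {b : Bool} {l m : List α} (h : altB b l m = true) : altB b m l = false := by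
  induction l generalizing b m with
  | nil => simp [altB] at h
  | cons x l ih =>
    cases m with
    | nil => simp [altB] at h
    | cons y m =>
      rcases eq_or_ne x y with rfl | hxy
      · simp only [altB_cons_self] at h ⊢
        exact ih h
      · cases b <;> simp only [altB, hxy, hxy.symm] at h ⊢ <;> simp_all [le_of_lt]

theorem altB_trans {b : Bool} {l m n : List α} (h₁ : altB b l m = true)
    (h₂ : altB b m n = true) : altB b l n = true := by
  induction l generalizing b m n with
  | nil => simp [altB] at h₁
  | cons x l ih =>
    cases m with
    | nil => simp [altB] at h₁
    | cons y m =>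
      cases n with
      | nil => simp [altB] at h₂
      | cons z n =>
        simp only [altB] at h₁ h₂ ⊢
        have := @ih (!b) m n
        cases b <;> grind

theorem altB_total (b : Bool) {l m : List α} (h : l.length = m.length) :
    altB b l m = true ∨ l = m ∨ altB b m l = true := by
  induction l generalizing b m with
  | nil => cases m <;> simp_all
  | cons x l ih =>
    cases m with
    | nil => simp at h
    | cons y m =>
      rcases lt_trichotomy x y with hxy | rfl | hxy
      · cases b <;> simp [altB, hxy, hxy.ne, hxy.ne']
      · simp only [altB_cons_self, List.cons.injEq, true_and]
        exact ih (!b) (by simpa using h)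
      · cases b <;> simp [altB, hxy, hxy.ne, hxy.ne']

end altB

/-- `Admissible N S p l` says that `l` is a strictly increasing list of (value, index) pairs, all
above `p`, with values at most `N` and with every index of `S` used exactly once. -/
def Admissible (N : ℕ) : Finset ℕ → ℕ ×ₗ ℕ → List (ℕ ×ₗ ℕ) → Prop
  | S, _, [] => S = ∅
  | S, p, a :: l =>
      p < a ∧ (ofLex a).1 ≤ N ∧ (ofLex a).2 ∈ S ∧ Admissible N (S.erase (ofLex a).2) a l

namespace Admissible

variable {N : ℕ} {S : Finset ℕ} {p p' : ℕ ×ₗ ℕ} {l m : List (ℕ ×ₗ ℕ)}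

theorem length_eq (h : Admissible N S p l) : l.length = S.card := by
  induction l generalizing S p with
  | nil => simp [show S = ∅ from h]
  | cons a l ih =>
    obtain ⟨-, -, h₃, h₄⟩ := h
    rw [List.length_cons, ih h₄, Finset.card_erase_add_one h₃]

theorem of_mem (h : Admissible N S p l) {a : ℕ ×ₗ ℕ} (ha : a ∈ l) :
    p < a ∧ (ofLex a).1 ≤ N ∧ (ofLex a).2 ∈ S := by
  induction l generalizing S p with
  | nil => simp at ha
  | cons b l ih =>
    obtain ⟨h₁, h₂, h₃, h₄⟩ := h
    rcases List.mem_cons.1 ha with rfl | ha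
    · exact ⟨h₁, h₂, h₃⟩
    · obtain ⟨g₁, g₂, g₃⟩ := ih h₄ ha
      exact ⟨h₁.trans g₁, g₂, Finset.mem_of_mem_erase g₃⟩

theorem exists_mem (h : Admissible N S p l) {i : ℕ} (hi : i ∈ S) :
    ∃ a ∈ l, (ofLex a).2 = i := by
  induction l generalizing S p with
  | nil => simp [show S = ∅ from h] at hi
  | cons b l ih =>
    obtain ⟨h₁, h₂, h₃, h₄⟩ := h
    by_cases hb : (ofLex b).2 = i
    · exact ⟨b, by simp, hb⟩
    · obtain ⟨a, ha, hai⟩ := ih h₄ (Finset.mem_erase.2 ⟨Ne.symm hb, hi⟩)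
      exact ⟨a, by simp [ha], hai⟩

theorem eq_of_snd_eq (h : Admissible N S p l) {a b : ℕ ×ₗ ℕ} (ha : a ∈ l) (hb : b ∈ l)
    (hab : (ofLex a).2 = (ofLex b).2) : a = b := by
  induction l generalizing S p with
  | nil => simp at ha
  | cons c l ih =>
    obtain ⟨-, -, -, h₄⟩ := h
    rcases List.mem_cons.1 ha with rfl | ha' <;> rcases List.mem_cons.1 hb with rfl | hb'
    · rfl
    · exact absurd hab.symm (Finset.ne_of_mem_erase (h₄.of_mem hb').2.2)
    · exact absurd hab (Finset.ne_of_mem_erase (h₄.of_mem ha').2.2)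
    · exact ih h₄ ha' hb'

theorem pairwise_lt (h : Admissible N S p l) : l.Pairwise (· < ·) := by
  induction l generalizing S p with
  | nil => simp
  | cons a l ih =>
    obtain ⟨-, -, -, h₄⟩ := h
    exact List.pairwise_cons.2 ⟨fun b hb => (h₄.of_mem hb).1, ih h₄⟩

theorem of_pairwise_lt (hl : l.Pairwise (· < ·)) (hn : (l.map fun a => (ofLex a).2).Nodup)
    (hp : ∀ a ∈ l, p < a) (hN : ∀ a ∈ l, (ofLex a).1 ≤ N)
    (hS : ∀ i, i ∈ S ↔ i ∈ l.map fun a => (ofLex a).2) : Admissible N S p l := by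
  induction l generalizing S p with
  | nil => exact Finset.eq_empty_of_forall_notMem fun i hi => by simpa using (hS i).1 hi
  | cons a l ih =>
    rw [List.pairwise_cons] at hl
    rw [List.map_cons, List.nodup_cons] at hn
    refine ⟨hp a (by simp), hN a (by simp), (hS _).2 (by simp), ih hl.2 hn.2 hl.1
      (fun b hb => hN b (by simp [hb])) fun i => ?_⟩
    rw [Finset.mem_erase, hS, List.map_cons, List.mem_cons]
    constructor
    · rintro ⟨h₁, h₂ | h₂⟩
      · exact absurd h₂ h₁
      · exact h₂
    · intro h
      exact ⟨fun e => hn.1 (e ▸ h), Or.inr h⟩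

theorem exists_const (h : ∀ i ∈ S, p < toLex (N, i)) :
    ∃ l, Admissible N S p l ∧ ∀ a ∈ l, (ofLex a).1 = N := by
  induction hn : S.card generalizing S p with
  | zero => exact ⟨[], Finset.card_eq_zero.1 hn, by simp⟩
  | succ n ih =>
    have hne : S.Nonempty := Finset.card_pos.1 (by omega)
    have hmem := S.min'_mem hne
    obtain ⟨l, hl, hlN⟩ := @ih (S.erase (S.min' hne)) (toLex (N, S.min' hne))
      (fun i hi => by
        have := S.min'_le i (Finset.mem_of_mem_erase hi)
        have := Finset.ne_of_mem_erase hi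
        rw [Prod.Lex.lt_iff]
        simp only [ofLex_toLex]
        exact Or.inr ⟨trivial, by omega⟩)
      (by rw [Finset.card_erase_of_mem hmem]; omega)
    exact ⟨toLex (N, S.min' hne) :: l, ⟨h _ hmem, le_rfl, hmem, hl⟩, by simpa using hlN⟩

theorem eq_of_const (hl : Admissible N S p l) (hm : Admissible N S p' m)
    (hlN : ∀ a ∈ l, (ofLex a).1 = N) (hmN : ∀ a ∈ m, (ofLex a).1 = N) : l = m := by
  have key : ∀ {l m p p'}, Admissible N S p l → Admissible N S p' m →
      (∀ a ∈ l, (ofLex a).1 = N) → (∀ a ∈ m, (ofLex a).1 = N) → ∀ a ∈ l, a ∈ m := by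
    intro l m p p' hl hm hlN hmN a ha
    obtain ⟨b, hb, hba⟩ := hm.exists_mem (hl.of_mem ha).2.2
    rwa [Prod.Lex.ext_ofLex ((hlN a ha).trans (hmN b hb).symm) hba.symm]
  have hperm : l.Perm m := (List.perm_ext_iff_of_nodup
    (hl.pairwise_lt.imp fun h => h.ne) (hm.pairwise_lt.imp fun h => h.ne)).2
    fun a => ⟨key hl hm hlN hmN a, key hm hl hmN hlN a⟩
  exact hperm.eq_of_pairwise (fun a b _ _ h₁ h₂ => absurd h₁ h₂.asymm)
    hl.pairwise_lt hm.pairwise_lt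

theorem altB_or_eq_of_const (hl : Admissible N S p l) (hm : Admissible N S p m)
    (hmN : ∀ a ∈ m, (ofLex a).1 = N) : altB true l m = true ∨ l = m := by
  cases l with
  | nil => cases m with
    | nil => exact Or.inr rfl
    | cons b m => simpa using hl.length_eq.trans hm.length_eq.symm
  | cons a l => cases m with
    | nil => simpa using hl.length_eq.trans hm.length_eq.symm
    | cons b m =>
      rcases lt_or_ge a b with hab | hab
      · exact Or.inl (altB_cons_of_lt hab l m)
      · refine Or.inr (hl.eq_of_const hm (fun c hc => ?_) hmN)
        have hbc : b ≤ c := by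
          rcases List.mem_cons.1 hc with rfl | hc
          · exact hab
          · exact hab.trans (hl.2.2.2.of_mem hc).1.le
        have hb := hmN b (by simp)
        have hcN := (hl.of_mem hc).2.1
        rw [Prod.Lex.le_iff] at hbc
        omega

/-- If the first entries of two admissible lists differ and no admissible list lies strictly
between them, then they agree outside a single index. -/
theorem exists_agree_of_head_lt {q q' : ℕ ×ₗ ℕ} (hl : Admissible N S p (q :: l))
    (hm : Admissible N S p (q' :: m)) (hqq' : q < q')
    (hbtw : ∀ z, Admissible N S p z → altB true (q :: l) z = true →
      altB true z (q' :: m) = true → False) :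
    ∃ j, ∀ a : ℕ ×ₗ ℕ, (ofLex a).2 ≠ j → (a ∈ q :: l ↔ a ∈ q' :: m) := by
  obtain ⟨hpq, hqN, hqS, hl'⟩ := id hl
  obtain ⟨hpq', hqN', hqS', hm'⟩ := id hm
  cases l with
  | nil =>
    have hS : ∀ i ∈ S, i = (ofLex q).2 := fun i hi => by
      by_contra hne
      exact Finset.notMem_empty i (hl' ▸ Finset.mem_erase.2 ⟨hne, hi⟩)
    refine ⟨(ofLex q).2, fun a ha => ⟨fun h => ?_, fun h => ?_⟩⟩
    · exact absurd (hS _ (hl.of_mem h).2.2) ha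
    · exact absurd (hS _ (hm.of_mem h).2.2) ha
  | cons h t =>
    obtain ⟨hqh, hhN, hhS, ht⟩ := id hl'
    obtain ⟨r, ⟨hqr, hrS, hrN⟩, hmin⟩ := (wellFounded_lt (α := ℕ ×ₗ ℕ)).has_min
      {r | q < r ∧ (ofLex r).2 ∈ S.erase (ofLex q).2 ∧ (ofLex r).1 ≤ N} ⟨h, hqh, hhS, hhN⟩
    have hmin' : ∀ x : ℕ ×ₗ ℕ, q < x → (ofLex x).2 ∈ S.erase (ofLex q).2 →
        (ofLex x).1 ≤ N → r ≤ x := fun x h₁ h₂ h₃ => not_lt.1 (hmin x ⟨h₁, h₂, h₃⟩)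
    have hrq' : r ≤ q' := by
      by_cases hidx : (ofLex q').2 = (ofLex q).2
      · rw [Prod.Lex.lt_iff] at hqq'
        have hne := Finset.ne_of_mem_erase hhS
        rcases lt_or_ge (ofLex q).2 (ofLex h).2 with hlt | hge
        · refine (hmin' (toLex ((ofLex q).1, (ofLex h).2)) ?_ hhS hqN).trans ?_
          · rw [Prod.Lex.lt_iff]; simp only [ofLex_toLex]; exact Or.inr ⟨trivial, hlt⟩
          · rw [Prod.Lex.le_iff]; simp only [ofLex_toLex]; omega
        · refine (hmin' (toLex ((ofLex q).1 + 1, (ofLex h).2)) ?_ hhS ?_).trans ?_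
          · rw [Prod.Lex.lt_iff]; simp only [ofLex_toLex]; omega
          · simp only [ofLex_toLex]; omega
          · rw [Prod.Lex.le_iff]; simp only [ofLex_toLex]; omega
      · exact hmin' q' hqq' (Finset.mem_erase.2 ⟨hidx, hqS'⟩) hqN'
    have hconst : ∀ i ∈ (S.erase (ofLex q).2).erase (ofLex r).2, r < toLex (N, i) := by
      intro i hi
      rw [Finset.mem_erase] at hi
      obtain ⟨x, hx, rfl⟩ := hl'.exists_mem hi.2
      obtain ⟨hqx, hxN, -⟩ := hl'.of_mem hx
      refine lt_of_le_of_ne (hmin' _ (hqx.trans_le ?_) hi.2 le_rfl) fun e => hi.1 ?_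
      · rw [Prod.Lex.le_iff]; simp only [ofLex_toLex]; omega
      · rw [e, ofLex_toLex]
    have hconst' : ∀ i ∈ S.erase (ofLex r).2, r < toLex (N, i) := by
      intro i hi
      rw [Finset.mem_erase] at hi
      by_cases hiq : i = (ofLex q).2
      · subst hiq
        obtain ⟨x, hx, hxi⟩ := hm.exists_mem hqS
        have hxN := (hm.of_mem hx).2.1
        have hqx : q' ≤ x := by
          rcases List.mem_cons.1 hx with rfl | hx
          · exact le_rfl
          · exact (hm'.of_mem hx).1.le
        refine lt_of_le_of_ne ((hrq'.trans hqx).trans ?_) fun e => hi.1 ?_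
        · rw [Prod.Lex.le_iff]; simp only [ofLex_toLex]; omega
        · rw [e, ofLex_toLex]
      · exact hconst i (Finset.mem_erase.2 ⟨hi.1, Finset.mem_erase.2 ⟨hiq, hi.2⟩⟩)
    obtain ⟨L, hL, hLN⟩ := exists_const hconst
    obtain ⟨M, hM, hMN⟩ := exists_const hconst'
    have hz₁ : Admissible N S p (q :: r :: L) := ⟨hpq, hqN, hqS, hqr, hrN, hrS, hL⟩
    have hz₂ : Admissible N S p (r :: M) :=
      ⟨hpq.trans hqr, hrN, Finset.mem_of_mem_erase hrS, hM⟩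
    have hl_eq : h :: t = r :: L := by
      have hnot : ¬ altB true (q :: h :: t) (q :: r :: L) = true := fun h' =>
        hbtw _ hz₁ h' (altB_cons_of_lt hqq' _ _)
      rw [altB_cons_self] at hnot
      rcases (hmin' h hqh hhS hhN).lt_or_eq with hlt | rfl
      · exact absurd (altB_cons_of_gt hlt t L) hnot
      · rw [altB_cons_self] at hnot
        rw [(altB_or_eq_of_const ht hL hLN).resolve_left hnot]
    have hm_eq : q' :: m = r :: M := by
      have hnot : ¬ altB true (r :: M) (q' :: m) = true := fun h' =>
        hbtw _ hz₂ (altB_cons_of_lt hqr _ _) h'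
      rcases hrq'.lt_or_eq with hlt | rfl
      · exact absurd (altB_cons_of_lt hlt M m) hnot
      · rw [altB_cons_self, altB_not_eq_swap true (hM.length_eq.trans hm'.length_eq.symm)] at hnot
        rw [(altB_or_eq_of_const hm' hM hMN).resolve_left hnot]
    refine ⟨(ofLex q).2, fun a ha => ?_⟩
    rw [hl_eq, hm_eq]
    have haq : a ≠ q := fun e => ha (by rw [e])
    simp only [List.mem_cons, haq, false_or]
    refine or_congr_right ⟨fun haL => ?_, fun haM => ?_⟩
    · obtain ⟨x, hx, hxa⟩ := hM.exists_mem (i := (ofLex a).2) <| by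
        have := (hL.of_mem haL).2.2
        simp only [Finset.mem_erase] at this ⊢
        tauto
      rwa [Prod.Lex.ext_ofLex ((hLN a haL).trans (hMN x hx).symm) hxa.symm]
    · obtain ⟨x, hx, hxa⟩ := hL.exists_mem (i := (ofLex a).2) <| by
        have := (hM.of_mem haM).2.2
        simp only [Finset.mem_erase] at this ⊢
        tauto
      rwa [Prod.Lex.ext_ofLex ((hMN a haM).trans (hLN x hx).symm) hxa.symm]

/-- Admissible lists that are neighbours in the alternating order agree outside one index. -/
theorem exists_agree {b : Bool} (hl : Admissible N S p l) (hm : Admissible N S p m)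
    (hlm : altB b l m = true)
    (hbtw : ∀ z, Admissible N S p z → altB b l z = true → altB b z m = true → False) :
    ∃ j, ∀ a : ℕ ×ₗ ℕ, (ofLex a).2 ≠ j → (a ∈ l ↔ a ∈ m) := by
  induction l generalizing S p b m with
  | nil => simp [altB] at hlm
  | cons q l ih =>
    cases m with
    | nil => simp [altB] at hlm
    | cons q' m =>
      rcases eq_or_ne q q' with rfl | hne
      · obtain ⟨h₁, h₂, h₃, hl'⟩ := hl
        rw [altB_cons_self] at hlm
        obtain ⟨j, hj⟩ := ih hl' hm.2.2.2 hlm fun z hz hlz hzm =>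
          hbtw (q :: z) ⟨h₁, h₂, h₃, hz⟩ (by rwa [altB_cons_self]) (by rwa [altB_cons_self])
        exact ⟨j, fun a ha => by simp [hj a ha]⟩
      · cases b with
        | true =>
          have hlt : q < q' := by simpa [altB, hne] using hlm
          exact hl.exists_agree_of_head_lt hm hlt hbtw
        | false =>
          have hlt : q' < q := by simpa [altB, hne] using hlm
          obtain ⟨j, hj⟩ := hm.exists_agree_of_head_lt hl hlt fun z hz hmz hzl => by
            refine hbtw z hz ?_ ?_
            · rw [← altB_not_eq_swap false (hz.length_eq.trans hl.length_eq.symm)]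
              exact hzl
            · rw [← altB_not_eq_swap false (hm.length_eq.trans hz.length_eq.symm)]
              exact hmz
          exact ⟨j, fun a ha => (hj a ha).symm⟩

end Admissible

section Tsorted

variable {c : ℕ} {x y z : Fin c → ℕ}

theorem mem_Tsorted {a : ℕ ×ₗ ℕ} :
    a ∈ Tsorted x ↔ ∃ i : Fin c, toLex (x i, i.1 + 1) = a := by
  simp [Tsorted, Tlist, List.mem_ofFn]

theorem length_Tsorted : (Tsorted x).length = c := by
  simp [Tsorted, Tlist]

theorem toLex_mem_Tsorted (i : Fin c) {v : ℕ} :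
    toLex (v, i.1 + 1) ∈ Tsorted x ↔ x i = v := by
  rw [mem_Tsorted]
  constructor
  · rintro ⟨k, hk⟩
    obtain ⟨h₁, h₂⟩ := Prod.mk.inj (toLex.injective hk)
    obtain rfl : k = i := Fin.ext (by omega)
    exact h₁
  · rintro rfl
    exact ⟨i, rfl⟩

theorem Tsorted_injective : Function.Injective (Tsorted (c := c)) := by
  intro x y h
  ext i
  exact ((toLex_mem_Tsorted i).1 (h ▸ (toLex_mem_Tsorted i).2 rfl)).symm

theorem nodup_map_snd_Tsorted : ((Tsorted x).map fun a => (ofLex a).2).Nodup := by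
  have hperm : (Tsorted x).Perm (Tlist x) := List.perm_insertionSort _ _
  rw [(hperm.map _).nodup_iff, Tlist, List.map_ofFn, List.nodup_ofFn]
  intro i k hik
  exact Fin.ext (by simpa using hik)

theorem pairwise_lt_Tsorted : (Tsorted x).Pairwise (· < ·) := by
  have hle : (Tsorted x).Pairwise (· ≤ ·) := List.pairwise_insertionSort _ _
  have hne : (Tsorted x).Pairwise (· ≠ ·) := nodup_map_snd_Tsorted.of_map
  exact (hle.and hne).imp fun h => lt_of_le_of_ne h.1 h.2

theorem admissible_Tsorted {N : ℕ} (hx : ∀ i, 1 ≤ x i ∧ x i ≤ N) :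
    Admissible N (Finset.Icc 1 c) (toLex (1, 0)) (Tsorted x) := by
  refine .of_pairwise_lt pairwise_lt_Tsorted nodup_map_snd_Tsorted ?_ ?_ fun i => ?_
  · intro a ha
    obtain ⟨i, rfl⟩ := mem_Tsorted.1 ha
    have := hx i
    rw [Prod.Lex.lt_iff]
    simp only [ofLex_toLex]
    omega
  · intro a ha
    obtain ⟨i, rfl⟩ := mem_Tsorted.1 ha
    exact (hx i).2
  · rw [Finset.mem_Icc, List.mem_map]
    constructor
    · intro hi
      exact ⟨_, mem_Tsorted.2 ⟨⟨i - 1, by omega⟩, rfl⟩, by simp only [ofLex_toLex]; omega⟩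
    · rintro ⟨a, ha, rfl⟩
      obtain ⟨k, rfl⟩ := mem_Tsorted.1 ha
      simp only [ofLex_toLex]
      omega

theorem Admissible.exists_Tsorted_eq {N : ℕ} {l : List (ℕ ×ₗ ℕ)}
    (h : Admissible N (Finset.Icc 1 c) (toLex (1, 0)) l) :
    ∃ z : Fin c → ℕ, (∀ i, 1 ≤ z i ∧ z i ≤ N) ∧ Tsorted z = l := by
  have hex : ∀ i : Fin c, ∃ a ∈ l, (ofLex a).2 = i.1 + 1 := fun i =>
    h.exists_mem (Finset.mem_Icc.2 ⟨by omega, by omega⟩)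
  choose f hf hfi using hex
  have hfe : ∀ i : Fin c, toLex ((ofLex (f i)).1, i.1 + 1) = f i := fun i =>
    Prod.Lex.ext_ofLex rfl (hfi i).symm
  refine ⟨fun i => (ofLex (f i)).1, fun i => ?_, ?_⟩
  · obtain ⟨h₁, h₂, -⟩ := h.of_mem (hf i)
    rw [Prod.Lex.lt_iff] at h₁
    simp only [ofLex_toLex] at h₁
    exact ⟨h₁.elim le_of_lt fun h => h.1.le, h₂⟩
  · refine List.Perm.eq_of_pairwise (fun a b _ _ h₁ h₂ => absurd h₁ h₂.asymm)
      pairwise_lt_Tsorted h.pairwise_lt ((List.perm_ext_iff_of_nodup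
        (pairwise_lt_Tsorted.imp fun h => h.ne) (h.pairwise_lt.imp fun h => h.ne)).2 fun a => ?_)
    rw [mem_Tsorted]
    constructor
    · rintro ⟨i, rfl⟩
      rw [hfe]
      exact hf i
    · intro ha
      have hi := Finset.mem_Icc.1 (h.of_mem ha).2.2
      refine ⟨⟨(ofLex a).2 - 1, by omega⟩, ?_⟩
      rw [hfe]
      refine h.eq_of_snd_eq (hf _) ha ?_
      rw [hfi]
      simp only
      omega

theorem vortexLt_asymm (h : vortexLt x y) : ¬ vortexLt y x := by
  simp [vortexLt, altLt, altB_asymm h]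

instance : Std.Total (vortexLe (c := c)) where
  total x y := by
    rcases altB_total true ((length_Tsorted (x := x)).trans (length_Tsorted (x := y)).symm)
      with h | h | h
    · exact Or.inl (Or.inl h)
    · exact Or.inl (Or.inr (Tsorted_injective h))
    · exact Or.inr (Or.inl h)

instance : IsTrans (Fin c → ℕ) vortexLe where
  trans x y z := by
    rintro (hxy | rfl) (hyz | rfl)
    · exact Or.inl (altB_trans hxy hyz)
    · exact Or.inl hxy
    · exact Or.inl hyz
    · exact Or.inr rfl

theorem mem_vortexList {Ns : Fin c → ℕ} : x ∈ vortexList Ns ↔ ∀ i, 1 ≤ x i ∧ x i ≤ Ns i := by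
  simp [vortexList, Fintype.mem_piFinset]

theorem nodup_vortexList (Ns : Fin c → ℕ) : (vortexList Ns).Nodup :=
  (List.perm_insertionSort _ _).nodup_iff.2 (Finset.nodup_toList _)

theorem hammingDist_eq_one_of_agree {j : ℕ} (hne : x ≠ y)
    (h : ∀ a : ℕ ×ₗ ℕ, (ofLex a).2 ≠ j → (a ∈ Tsorted x ↔ a ∈ Tsorted y)) :
    hammingDist x y = 1 := by
  refine le_antisymm (Finset.card_le_one.2 ?_) (hammingDist_pos.2 hne)
  have key : ∀ i : Fin c, x i ≠ y i → i.1 + 1 = j := fun i hi => by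
    by_contra hij
    exact hi ((toLex_mem_Tsorted i).1 ((h (toLex (x i, i.1 + 1)) hij).1
      ((toLex_mem_Tsorted i).2 rfl))).symm
  intro i hi k hk
  have := key i (Finset.mem_filter.1 hi).2
  have := key k (Finset.mem_filter.1 hk).2
  exact Fin.ext (by omega)

end Tsorted

/-- The Vortex order is an `N`-ary Gray code: for all `N ≥ 1` and `c ≥ 1`, the
list of all tuples of `{1,…,N}^c` sorted in increasing Vortex order is a Gray
code. -/
theorem stmt18 (N c : ℕ) (hN : 1 ≤ N) (hc : 1 ≤ c) :
    IsGrayCode (vortexList fun _ : Fin c => N) := by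
  refine List.isChain_iff_forall_rel_of_append_cons_cons.2 fun x y l₁ l₂ hl => ?_
  have hsort : (vortexList fun _ : Fin c => N).Pairwise vortexLe := List.pairwise_insertionSort _ _
  have hnodup := nodup_vortexList fun _ : Fin c => N
  have hx := (mem_vortexList (Ns := fun _ : Fin c => N) (x := x)).1 (by simp [hl])
  have hy := (mem_vortexList (Ns := fun _ : Fin c => N) (x := y)).1 (by simp [hl])
  have hsplit : ∀ z ∈ vortexList (fun _ : Fin c => N), vortexLe z x ∨ vortexLe y z := by
    intro z hz
    rw [hl, List.pairwise_append] at hsort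
    obtain ⟨-, h₂, h₃⟩ := hsort
    rw [List.pairwise_cons, List.pairwise_cons] at h₂
    rw [hl, List.mem_append, List.mem_cons, List.mem_cons] at hz
    rcases hz with hz | rfl | rfl | hz
    · exact Or.inl (h₃ z hz x (by simp))
    · exact Or.inl (Or.inr rfl)
    · exact Or.inr (Or.inr rfl)
    · exact Or.inr (h₂.2.1 z hz)
  have hne : x ≠ y := by
    rintro rfl
    simp [hl, List.nodup_append] at hnodup
  have hxy : vortexLt x y := by
    rw [hl, List.pairwise_append, List.pairwise_cons] at hsort
    exact (hsort.2.1.1 y (by simp)).resolve_right hne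
  obtain ⟨j, hj⟩ := (admissible_Tsorted hx).exists_agree (admissible_Tsorted hy) hxy
    fun l hadm hxl hly => by
      obtain ⟨z, hz, rfl⟩ := hadm.exists_Tsorted_eq
      rcases hsplit z (mem_vortexList.2 hz) with (h | rfl) | (h | rfl)
      · exact vortexLt_asymm h hxl
      · exact vortexLt_asymm hxl hxl
      · exact vortexLt_asymm h hly
      · exact vortexLt_asymm hly hly
  exact hammingDist_eq_one_of_agree hne hj
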